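/- arXiv:1308.5844 — 6 statements merged into one kernel-verified Lean document; each statement's English description precedes it below -/
import Mathlib

section
/- Let H be a sparse numerical semigroup of genus g = 2κ + j for some j ≥ 0, with Frobenius number ℓ_g = 2g - κ (where κ := 2g - ℓ_g). Then there exists a sparse numerical semigroup H̃ of genus g̃ = 2κ - 1 with Frobenius number ℓ_{g̃} = 2g̃ - κ = 3κ - 2 such that H ⊆ H̃. -/
/-- `H` is a numerical semigroup of genus `g`: it contains `0`, is closed under
addition, and its complement in `ℕ` (the set of gaps) is finite with exactly
`g` elements. -/
def IsNumericalSemigroupOfGenus (H : Set ℕ) (g : ℕ) : Prop :=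
  0 ∈ H ∧ (∀ a ∈ H, ∀ b ∈ H, a + b ∈ H) ∧ Hᶜ.Finite ∧ Hᶜ.ncard = g

/-- The `i`-th gap `ℓ_i` of `H` (1-indexed): the `i`-th smallest element of `ℕ \ H`.
In particular, if `H` has genus `g`, then `gap H g` is the Frobenius number of `H`. -/
noncomputable def gap (H : Set ℕ) (i : ℕ) : ℕ :=
  Nat.nth (fun n => n ∉ H) (i - 1)

/-- A numerical semigroup `H` of genus `g` is sparse if any two subsequent gaps
differ by at most `2`. -/
def IsSparse (H : Set ℕ) (g : ℕ) : Prop :=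
  ∀ i, 1 ≤ i → i ≤ g - 1 → gap H (i + 1) - gap H i ≤ 2

/-- `D`, the number of double leaps of `H` (of genus `g`). -/
noncomputable def numDouble (H : Set ℕ) (g : ℕ) : ℕ :=
  {i : ℕ | 1 ≤ i ∧ i ≤ g - 1 ∧ gap H (i + 1) - gap H i = 2}.ncard

/-- `S`, the number of single leaps of `H` (of genus `g`). -/
noncomputable def numSingle (H : Set ℕ) (g : ℕ) : ℕ :=
  {i : ℕ | 1 ≤ i ∧ i ≤ g - 1 ∧ gap H (i + 1) - gap H i = 1}.ncard

open Classical in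
theorem IsNumericalSemigroupOfGenus.gap_notMem {H : Set ℕ} {g i : ℕ}
    (hH : IsNumericalSemigroupOfGenus H g) (hi : 1 ≤ i) (hig : i ≤ g) : gap H i ∉ H := by
  obtain ⟨-, -, hfin, hcard⟩ := hH
  refine Nat.nth_mem (p := fun n => n ∉ H) (i - 1) fun hf => ?_
  rw [← Set.ncard_eq_toFinset_card _ hf]
  change i - 1 < Hᶜ.ncard
  omega

open Classical in
theorem IsNumericalSemigroupOfGenus.count_gap {H : Set ℕ} {g i : ℕ}
    (hH : IsNumericalSemigroupOfGenus H g) (hi : 1 ≤ i) (hig : i ≤ g) :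
    Nat.count (fun n => n ∉ H) (gap H i) = i - 1 := by
  obtain ⟨-, -, hfin, hcard⟩ := hH
  refine Nat.count_nth (p := fun n => n ∉ H) fun hf => ?_
  rw [← Set.ncard_eq_toFinset_card _ hf]
  change i - 1 < Hᶜ.ncard
  omega

theorem gap_eq_of_count_eq {H : Set ℕ} [DecidablePred fun n => n ∉ H] {i n : ℕ} (hn : n ∉ H)
    (hc : Nat.count (fun n => n ∉ H) n = i - 1) : gap H i = n := by
  rw [gap, ← hc]
  exact Nat.nth_count (p := fun n => n ∉ H) hn

open Classical in
theorem IsNumericalSemigroupOfGenus.gap_lt_gap {H : Set ℕ} {g i k : ℕ}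
    (hH : IsNumericalSemigroupOfGenus H g) (hi : 1 ≤ i) (hik : i < k) (hkg : k ≤ g) :
    gap H i < gap H k := by
  by_contra! h
  have := Nat.count_monotone (fun n => n ∉ H) h
  rw [hH.count_gap hi (by omega), hH.count_gap (by omega) hkg] at this
  omega

theorem IsNumericalSemigroupOfGenus.one_notMem {H : Set ℕ} {g : ℕ}
    (hH : IsNumericalSemigroupOfGenus H g) (hg : 1 ≤ g) : 1 ∉ H := by
  intro h1
  have hall : ∀ n, n ∈ H := fun n => by
    induction n with
    | zero => exact hH.1
    | succ n ih => exact hH.2.1 n ih 1 h1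
  exact hH.gap_notMem le_rfl hg (hall _)

open Classical in
/-- Below the Frobenius number, a sparse semigroup has no two consecutive elements. -/
theorem IsSparse.succ_notMem {H : Set ℕ} {g x : ℕ} (hs : IsSparse H g)
    (hH : IsNumericalSemigroupOfGenus H g) (hg : 1 ≤ g) (hx : x ∈ H) (hxg : x + 1 < gap H g) :
    x + 1 ∉ H := by
  intro hx'
  have h1 := hH.one_notMem hg
  have hx2 : 2 ≤ x := by
    rcases x with _ | _ | x
    · exact absurd hx' h1
    · exact absurd hx h1
    · omega
  have hc1 : 1 ≤ Nat.count (fun n => n ∉ H) x := by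
    have := Nat.count_monotone (fun n => n ∉ H) hx2
    have h2 : Nat.count (fun n => n ∉ H) 2 = 1 := by
      simp [Nat.count_succ, hH.1, h1]
    omega
  have hc2 : Nat.count (fun n => n ∉ H) (x + 2) = Nat.count (fun n => n ∉ H) x := by
    simp [Nat.count_succ, hx, hx']
  have hcg : Nat.count (fun n => n ∉ H) (x + 2) ≤ g - 1 := by
    rw [← hH.count_gap hg le_rfl]
    exact Nat.count_monotone _ hxg
  set c := Nat.count (fun n => n ∉ H) x with hc
  have hlow : gap H c < x := Nat.nth_lt_of_lt_count (by omega)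
  have hhigh : x + 2 ≤ gap H (c + 1) := by
    by_contra! hlt
    have hle := Nat.count_monotone (fun n => n ∉ H) (show gap H (c + 1) + 1 ≤ x + 2 by omega)
    have hnot := hH.gap_notMem (show 1 ≤ c + 1 by omega) (by omega)
    rw [Nat.count_succ, hH.count_gap (by omega) (by omega), if_pos hnot] at hle
    omega
  have := hs c hc1 (by omega)
  omega

open Classical in
theorem IsNumericalSemigroupOfGenus.card_notMem_range {H : Set ℕ} {g i : ℕ}
    (hH : IsNumericalSemigroupOfGenus H g) (hi : 1 ≤ i) (hig : i ≤ g) :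
    ((Finset.range (gap H i + 1)).filter (fun n => n ∉ H)).card = i := by
  rw [← Nat.count_eq_card_filter_range, Nat.count_succ, hH.count_gap hi hig,
    if_pos (hH.gap_notMem hi hig)]
  omega

open Classical in
theorem IsNumericalSemigroupOfGenus.card_mem_range {H : Set ℕ} {g i : ℕ}
    (hH : IsNumericalSemigroupOfGenus H g) (hi : 1 ≤ i) (hig : i ≤ g) :
    ((Finset.range (gap H i + 1)).filter (fun n => n ∈ H)).card + i = gap H i + 1 := by
  have := Finset.card_filter_add_card_filter_not (s := Finset.range (gap H i + 1)) (fun n => n ∈ H)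
  rwa [hH.card_notMem_range hi hig, Finset.card_range] at this

theorem IsNumericalSemigroupOfGenus.sub_notMem {H : Set ℕ} {g f x : ℕ}
    (hH : IsNumericalSemigroupOfGenus H g) (hf : f ∉ H) (hx : x ∈ H) (hxf : x ≤ f) :
    f - x ∉ H := fun h => hf <| by
  simpa [Nat.sub_add_cancel hxf] using hH.2.1 _ h _ hx

open Classical in
theorem IsNumericalSemigroupOfGenus.gap_lt_two_mul {H : Set ℕ} {g i : ℕ}
    (hH : IsNumericalSemigroupOfGenus H g) (hi : 1 ≤ i) (hig : i ≤ g) : gap H i < 2 * i := by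
  have hle : ((Finset.range (gap H i + 1)).filter (fun n => n ∈ H)).card ≤
      ((Finset.range (gap H i + 1)).filter (fun n => n ∉ H)).card := by
    refine Finset.card_le_card_of_injOn (fun x => gap H i - x) ?_ ?_
    · intro x hx
      simp only [Finset.coe_filter, Finset.mem_range, Set.mem_ofPred_eq] at hx ⊢
      exact ⟨by omega, hH.sub_notMem (hH.gap_notMem hi hig) hx.2 (by omega)⟩
    · intro x hx y hy hxy
      simp only [Finset.coe_filter, Finset.mem_range, Set.mem_ofPred_eq] at hx hy hxy
      omega
  have := hH.card_mem_range hi hig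
  have := hH.card_notMem_range hi hig
  omega

open Classical in
/-- If `f = ℓ_i` and `f - 1` are both gaps of a sparse semigroup, then the reflections `x ↦ f - x`
and `x ↦ f - 1 - x` send the elements of `H` below `f` to disjoint sets of gaps. -/
theorem IsSparse.two_mul_gap_lt {H : Set ℕ} {g i : ℕ} (hs : IsSparse H g)
    (hH : IsNumericalSemigroupOfGenus H g) (hi : 1 ≤ i) (hig : i ≤ g)
    (hpred : gap H i - 1 ∉ H) : 2 * gap H i + 2 ≤ 3 * i := by
  have hf := hH.gap_notMem hi hig
  have hcard := hH.card_mem_range hi hig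
  have hcard' := hH.card_notMem_range hi hig
  have hfg : gap H i ≤ gap H g := by
    rcases hig.eq_or_lt with rfl | h
    · exact le_rfl
    · exact (hH.gap_lt_gap hi h le_rfl).le
  set f := gap H i
  set A := (Finset.range (f + 1)).filter (fun n => n ∈ H) with hA
  set B := (Finset.range (f + 1)).filter (fun n => n ∉ H) with hB
  have hAlt : ∀ x ∈ A, x ∈ H ∧ x < f := by
    intro x hx
    simp only [hA, Finset.mem_filter, Finset.mem_range] at hx
    have : x ≠ f := fun h => hf (h ▸ hx.2)
    exact ⟨hx.2, by omega⟩
  have hinj₁ : Set.InjOn (fun x => f - x) A := fun x hx y hy hxy => by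
    have := (hAlt x hx).2
    have := (hAlt y hy).2
    simp only at hxy
    omega
  have hinj₂ : Set.InjOn (fun x => f - 1 - x) A := fun x hx y hy hxy => by
    have := (hAlt x hx).2
    have := (hAlt y hy).2
    simp only at hxy
    omega
  have hdisj : Disjoint (A.image fun x => f - x) (A.image fun x => f - 1 - x) := by
    rw [Finset.disjoint_left]
    intro z hz hz'
    obtain ⟨x, hx, rfl⟩ := Finset.mem_image.1 hz
    obtain ⟨y, hy, hxy⟩ := Finset.mem_image.1 hz'
    obtain ⟨hxH, hxf⟩ := hAlt x hx
    obtain ⟨hyH, hyf⟩ := hAlt y hy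
    obtain rfl : x = y + 1 := by omega
    exact hs.succ_notMem hH (by omega) hyH (by omega) hxH
  have hsub : (A.image fun x => f - x) ∪ (A.image fun x => f - 1 - x) ⊆ B := by
    refine Finset.union_subset ?_ ?_ <;>
    · refine Finset.image_subset_iff.2 fun x hx => ?_
      obtain ⟨hxH, hxf⟩ := hAlt x hx
      simp only [hB, Finset.mem_filter, Finset.mem_range]
      exact ⟨by omega, hH.sub_notMem (by assumption) hxH (by omega)⟩
  have := Finset.card_le_card hsub
  rw [Finset.card_union_of_disjoint hdisj, Finset.card_image_of_injOn hinj₁,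
    Finset.card_image_of_injOn hinj₂] at this
  omega

/-- In a sparse semigroup with `ℓ_g = 2g - κ`, all leaps after the `(2κ - 1)`-st gap are double. -/
theorem IsSparse.gap_add_eq {H : Set ℕ} {g κ i : ℕ} (hs : IsSparse H g)
    (hH : IsNumericalSemigroupOfGenus H g) (hκ : 1 ≤ κ) (hF : gap H g + κ = 2 * g)
    (hi : 2 * κ - 1 ≤ i) (hig : i ≤ g) : gap H i + κ = 2 * i := by
  induction hig using Nat.decreasingInduction with
  | self => exact hF
  | of_succ k hkg ih =>
    have ih := ih (by omega)
    have hlt := hH.gap_lt_gap (show 1 ≤ k by omega) (Nat.lt_succ_self k) hkg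
    have hle := hs k (by omega) (by omega)
    have hne : gap H (k + 1) - 1 ≠ gap H k := fun h => by
      have := hs.two_mul_gap_lt hH (by omega) hkg (h ▸ hH.gap_notMem (by omega) (by omega))
      omega
    simp only [Nat.succ_eq_add_one] at hlt
    omega

open Classical in
theorem gap_union_Ioi {H : Set ℕ} {g m i : ℕ} (hH : IsNumericalSemigroupOfGenus H g)
    (hmg : m ≤ g) (hi : 1 ≤ i) (him : i ≤ m) : gap (H ∪ Set.Ioi (gap H m)) i = gap H i := by
  have hle : gap H i ≤ gap H m := by
    rcases him.eq_or_lt with rfl | h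
    · exact le_rfl
    · exact (hH.gap_lt_gap hi h hmg).le
  apply gap_eq_of_count_eq
  · simpa [hH.gap_notMem hi (him.trans hmg)] using hle
  · rw [← hH.count_gap hi (him.trans hmg), Nat.count_eq_card_filter_range,
      Nat.count_eq_card_filter_range]
    congr 1
    refine Finset.filter_congr fun x hx => ?_
    have := Finset.mem_range.1 hx
    simp only [Set.mem_union, Set.mem_Ioi]
    have : ¬ gap H m < x := by omega
    tauto

open Classical in
theorem IsNumericalSemigroupOfGenus.union_Ioi {H : Set ℕ} {g m : ℕ}
    (hH : IsNumericalSemigroupOfGenus H g) (hm : 1 ≤ m) (hmg : m ≤ g) :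
    IsNumericalSemigroupOfGenus (H ∪ Set.Ioi (gap H m)) m := by
  have hcompl : (H ∪ Set.Ioi (gap H m))ᶜ =
      ((Finset.range (gap H m + 1)).filter (fun n => n ∉ H) : Finset ℕ) := by
    ext x
    simp only [Set.mem_compl_iff, Set.mem_union, Set.mem_Ioi, Finset.coe_filter,
      Finset.mem_range, Set.mem_ofPred_eq, Nat.lt_succ_iff]
    rw [← not_lt]
    tauto
  refine ⟨Or.inl hH.1, ?_, ?_, ?_⟩
  · rintro a (ha | ha) b (hb | hb)
    · exact Or.inl (hH.2.1 a ha b hb)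
    all_goals
      right
      simp only [Set.mem_Ioi] at *
      omega
  · rw [hcompl]
    exact Finset.finite_toSet _
  · rw [hcompl, Set.ncard_coe_finset, hH.card_notMem_range hm hmg]

/-- **Lemma (reduction).** Let `H` be a sparse numerical semigroup of genus
`g = 2κ + j`, `j ≥ 0`, with Frobenius number `ℓ_g = 2g - κ`. Then there is a
sparse numerical semigroup `H̃` of genus `g̃ = 2κ - 1` with Frobenius number
`ℓ_{g̃} = 2g̃ - κ = 3κ - 2` such that `H ⊆ H̃`. -/
theorem reduction_to_limit (H : Set ℕ) (g κ j : ℕ) (hg : 1 < g)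
    (hH : IsNumericalSemigroupOfGenus H g) (hs : IsSparse H g)
    (hgj : g = 2 * κ + j) (hF : gap H g = 2 * g - κ) :
    ∃ H' : Set ℕ, IsNumericalSemigroupOfGenus H' (2 * κ - 1) ∧
      IsSparse H' (2 * κ - 1) ∧ gap H' (2 * κ - 1) = 3 * κ - 2 ∧ H ⊆ H' := by
  have hκ : 1 ≤ κ := by
    have := hH.gap_lt_two_mul (by omega) le_rfl
    omega
  have hgap := hs.gap_add_eq hH hκ (by omega) le_rfl (by omega)
  refine ⟨H ∪ Set.Ioi (gap H (2 * κ - 1)), hH.union_Ioi (by omega) (by omega), ?_, ?_,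
    Set.subset_union_left⟩
  · intro i hi hiκ
    rw [gap_union_Ioi hH (by omega) hi (by omega),
      gap_union_Ioi hH (by omega) (by omega) (by omega)]
    exact hs i hi (by omega)
  · rw [gap_union_Ioi hH (by omega) (by omega) le_rfl]
    omega
end

section
/- If H is a sparse numerical semigroup of genus g > 1 that is quasi-symmetric (i.e., its Frobenius number satisfies ℓ_g = 2g - 2), then either H = ℕ \ {1, 2} (the semigroup generated by 3, 4, 5) or H = ℕ \ {1, 2, 4} (the semigroup generated by 3, 5, 7). -/
/-- In a quasi-symmetric semigroup with Frobenius number `F = 2 * m`, the reflection `x ↦ F - x`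
sends gaps other than `m` to elements of the semigroup. -/
theorem sub_mem_of_notMem {H : Set ℕ} {m : ℕ}
    (hadd : ∀ a ∈ H, ∀ b ∈ H, a + b ∈ H) (hcard : Hᶜ.ncard = m + 1)
    (hle : ∀ x, x ∉ H → x ≤ 2 * m) (hF : 2 * m ∉ H) {x : ℕ} (hx : x ∉ H) (hxm : x ≠ m) :
    2 * m - x ∈ H := by
  classical
  set N := (Finset.range (2 * m + 1)).filter (· ∈ H) with hN
  set G := (Finset.range (2 * m + 1)).filter (· ∉ H) with hG
  have hGcard : G.card = m + 1 := by
    rw [← hcard, ← Set.ncard_coe_finset]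
    congr 1
    ext y
    simp only [hG, Finset.coe_filter, Finset.mem_range, Set.mem_ofPred_eq, Set.mem_compl_iff]
    exact ⟨fun h => h.2, fun h => ⟨Nat.lt_succ_of_le (hle y h), h⟩⟩
  have hNcard : N.card = m := by
    have h := Finset.card_filter_add_card_filter_not (s := Finset.range (2 * m + 1)) (· ∈ H)
    rw [Finset.card_range] at h
    change N.card + G.card = _ at h
    omega
  have hm : m ∉ H := fun h => hF (two_mul m ▸ hadd m h m h)
  have hmG : m ∈ G := by simp only [hG, Finset.mem_filter, Finset.mem_range]; exact ⟨by omega, hm⟩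
  have hsub : N.image (2 * m - ·) ⊆ G.erase m := by
    intro y hy
    simp only [hN, Finset.mem_image, Finset.mem_filter, Finset.mem_range] at hy
    obtain ⟨z, ⟨hz, hzH⟩, rfl⟩ := hy
    simp only [hG, Finset.mem_erase, Finset.mem_filter, Finset.mem_range]
    refine ⟨fun h => hm ?_, by omega, fun h => hF ?_⟩
    · rwa [show m = z by omega]
    · rw [show 2 * m = z + (2 * m - z) by omega]
      exact hadd z hzH _ h
  have himage : (N.image (2 * m - ·)).card = N.card := by
    refine Finset.card_image_of_injOn fun a ha b hb hab => ?_
    simp only [hN, Finset.coe_filter, Finset.mem_range, Set.mem_ofPred_eq] at ha hb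
    omega
  have heq := Finset.eq_of_subset_of_card_le hsub (by
    rw [Finset.card_erase_of_mem hmG, himage]; omega)
  have hxG : x ∈ G.erase m := by
    simp only [hG, Finset.mem_erase, Finset.mem_filter, Finset.mem_range]
    exact ⟨hxm, Nat.lt_succ_of_le (hle x hx), hx⟩
  rw [← heq] at hxG
  simp only [hN, Finset.mem_image, Finset.mem_filter, Finset.mem_range] at hxG
  obtain ⟨z, ⟨hz, hzH⟩, rfl⟩ := hxG
  rwa [show 2 * m - (2 * m - z) = z by omega]

/-- **Corollary.** If `H` is a sparse numerical semigroup of genus `g > 1` that is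
quasi-symmetric (`ℓ_g = 2g - 2`), then either `H = ℕ \ {1, 2} = ⟨3,4,5⟩` or
`H = ℕ \ {1, 2, 4} = ⟨3,5,7⟩`. -/
theorem quasi_symmetric_sparse (H : Set ℕ) (g : ℕ) (hg : 1 < g)
    (hH : IsNumericalSemigroupOfGenus H g) (hs : IsSparse H g)
    (hqsym : gap H g = 2 * g - 2) :
    H = ({1, 2} : Set ℕ)ᶜ ∨ H = ({1, 2, 4} : Set ℕ)ᶜ := by
  obtain ⟨h0, hadd, hfin, hcard⟩ := hH
  obtain ⟨m, rfl⟩ : ∃ m, g = m + 1 := ⟨g - 1, by omega⟩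
  have hcard' (hf : {n | n ∉ H}.Finite) : hf.toFinset.card = m + 1 := by
    rw [← hcard, Set.ncard_eq_toFinset_card _ hfin]
  have hlast : Nat.nth (fun n => n ∉ H) m = 2 * m := by
    simpa [gap, Nat.mul_add] using hqsym
  have hF : 2 * m ∉ H := by
    rw [← hlast]
    exact Nat.nth_mem (p := fun n => n ∉ H) m fun hf => by rw [hcard']; omega
  have hle : ∀ x, x ∉ H → x ≤ 2 * m := by
    intro x hx
    obtain ⟨i, hi, rfl⟩ := Nat.exists_lt_card_nth_eq (p := fun n => n ∉ H) hx
    have hi' := hi hfin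
    rw [hcard'] at hi'
    rw [← hlast]
    exact Nat.nth_le_nth' (by omega) fun hf => by rw [hcard']; omega
  have h2 : 2 ∉ H := by
    intro h
    have hmul : ∀ k, 2 * k ∈ H := by
      intro k
      induction k with
      | zero => exact h0
      | succ k ih => exact hadd _ ih _ h
    exact hF (hmul m)
  have h1 : 1 ∉ H := fun h => h2 (hadd 1 h 1 h)
  have hrefl {x : ℕ} (hx : x ∉ H) (hxm : x ≠ m) : 2 * m - x ∈ H :=
    sub_mem_of_notMem hadd hcard hle hF hx hxm
  have hm : m ≤ 2 := by
    by_contra! hm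
    have hF1 := hrefl h1 (by omega)
    have hF2 := hrefl h2 (by omega)
    have hprev : Nat.nth (fun n => n ∉ H) (m - 1) ∉ H :=
      Nat.nth_mem (p := fun n => n ∉ H) (m - 1) fun hf => by rw [hcard']; omega
    have hlt : Nat.nth (fun n => n ∉ H) (m - 1) < Nat.nth (fun n => n ∉ H) m :=
      Nat.nth_lt_nth' (by omega) fun hf => by rw [hcard']; omega
    have hgap := hs m (by omega) (by omega)
    simp only [gap, Nat.add_sub_cancel] at hgap
    rw [hlast] at hgap hlt
    rcases (by omega : Nat.nth (fun n => n ∉ H) (m - 1) = 2 * m - 1 ∨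
      Nat.nth (fun n => n ∉ H) (m - 1) = 2 * m - 2) with h | h
    · exact hprev (h ▸ hF1)
    · exact hprev (h ▸ hF2)
  obtain rfl | rfl : m = 1 ∨ m = 2 := by omega
  · left
    ext x
    simp only [Set.mem_compl_iff, Set.mem_insert_iff, Set.mem_singleton_iff]
    refine ⟨by rintro hx (rfl | rfl) <;> contradiction, fun hx => ?_⟩
    by_contra hxH
    have := hle x hxH
    have : x ≠ 0 := fun h => hxH (h ▸ h0)
    omega
  · right
    have h3 : 3 ∈ H := hrefl h1 (by omega)
    ext x
    simp only [Set.mem_compl_iff, Set.mem_insert_iff, Set.mem_singleton_iff]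
    refine ⟨by rintro hx (rfl | rfl | rfl) <;> contradiction, fun hx => ?_⟩
    by_contra hxH
    have := hle x hxH
    have : x ≠ 0 := fun h => hxH (h ▸ h0)
    have : x ≠ 3 := fun h => hxH (h ▸ h3)
    omega
end

section
/- Let H be a sparse numerical semigroup of genus g ≥ 3 with Frobenius number ℓ_g = 2g - 3. Then H is one of the following: (1) H = {0, 3} ∪ {n ∈ ℕ : n ≥ 6} (i.e., 3ℕ + H_5, of genus 4); (2) H = {0, 3, 6} ∪ {n ∈ ℕ : n ≥ 8} (i.e., 3ℕ + H_7, of genus 5); (3) H = {2k : k ∈ ℕ, k ≠ 1, 2k ≤ 2g - 4} ∪ {n ∈ ℕ : n ≥ 2g - 2}. -/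
/-- The gaps of a numerical semigroup of genus `g`, enumerated from `0`. -/
theorem exists_gap_enumeration {H : Set ℕ} {g : ℕ} (hH : IsNumericalSemigroupOfGenus H g) :
    (∀ i < g, gap H (i + 1) ∉ H) ∧
    (∀ i j, i < j → j < g → gap H (i + 1) < gap H (j + 1)) ∧
    (∀ n, n ∉ H → ∃ i < g, gap H (i + 1) = n) := by
  obtain ⟨-, -, hfin, hcard⟩ := hH
  have hfin' : {n | n ∉ H}.Finite := hfin
  have hc : hfin'.toFinset.card = g := by
    rw [← hcard, Set.ncard_eq_toFinset_card _ hfin]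
  refine ⟨fun i hi => ?_, fun i j hij hj => ?_, fun n hn => ?_⟩
  · exact Nat.nth_mem_of_lt_card (p := fun n => n ∉ H) hfin' (hi.trans_eq hc.symm)
  · exact Nat.nth_lt_nth_of_lt_card (p := fun n => n ∉ H) hfin' hij (hj.trans_eq hc.symm)
  · obtain ⟨i, hi, h⟩ := Nat.exists_lt_card_finite_nth_eq (p := fun n => n ∉ H) hfin' hn
    exact ⟨i, hi.trans_eq hc, h⟩

theorem mul_mem_of_add_closed {H : Set ℕ} (h0 : 0 ∈ H) (hadd : ∀ a ∈ H, ∀ b ∈ H, a + b ∈ H)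
    {a : ℕ} (ha : a ∈ H) (k : ℕ) : a * k ∈ H := by
  induction k with
  | zero => simpa using h0
  | succ k ih => exact hadd _ ih _ ha

/-- **Theorem.** Let `H` be a sparse numerical semigroup of genus `g ≥ 3` with
Frobenius number `ℓ_g = 2g - 3`. Then `H` is one of:
(1) `{0, 3} ∪ {n ≥ 6}` (i.e. `3ℕ + H_5`);
(2) `{0, 3, 6} ∪ {n ≥ 8}` (i.e. `3ℕ + H_7`);
(3) `{2k : k ≠ 1, 2k ≤ 2g - 4} ∪ {n ≥ 2g - 2}`. -/
theorem charact_frobenius_2g_sub_3 (H : Set ℕ) (g : ℕ) (hg : 3 ≤ g)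
    (hH : IsNumericalSemigroupOfGenus H g) (hs : IsSparse H g)
    (hF : gap H g = 2 * g - 3) :
    H = ({0, 3} : Set ℕ) ∪ {n : ℕ | 6 ≤ n} ∨
    H = ({0, 3, 6} : Set ℕ) ∪ {n : ℕ | 8 ≤ n} ∨
    H = {n : ℕ | ∃ k, k ≠ 1 ∧ n = 2 * k ∧ 2 * k ≤ 2 * g - 4} ∪
        {n : ℕ | 2 * g - 2 ≤ n} := by
  obtain ⟨hmem, hlt, hsurj⟩ := exists_gap_enumeration hH
  obtain ⟨h0, hadd, -, -⟩ := hH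
  have hstep : ∀ i, i + 1 < g → gap H (i + 1 + 1) = gap H (i + 1) + 1 ∨
      gap H (i + 1 + 1) = gap H (i + 1) + 2 := by
    intro i hi
    have h1 := hs (i + 1) (by omega) (by omega)
    have h2 := hlt i (i + 1) (by omega) hi
    omega
  obtain ⟨f, hf⟩ : ∃ f : ℕ → ℕ, ∀ i, f i = gap H (i + 1) := ⟨_, fun _ => rfl⟩
  have hlast : f (g - 1) = 2 * g - 3 := by
    rw [hf, Nat.sub_add_cancel (by omega), hF]
  simp only [← hf] at hmem hlt hsurj hstep
  have hskip : ∀ i n, i + 1 < g → f i < n → n < f (i + 1) → n ∈ H := by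
    intro i n hi h1 h2
    by_contra hn
    obtain ⟨j, hj, rfl⟩ := hsurj n hn
    rcases lt_trichotomy j i with h | rfl | h
    · have := hlt j i h (by omega)
      omega
    · omega
    · rcases eq_or_lt_of_le (show i + 1 ≤ j from h) with rfl | h'
      · omega
      · have := hlt (i + 1) j h' hj
        omega
  have hf0 : f 0 = 1 := by
    have h1 : (1 : ℕ) ∉ H := fun h => hmem 0 (by omega) (by
      simpa using mul_mem_of_add_closed h0 hadd h (f 0))
    have hne : f 0 ≠ 0 := fun h => hmem 0 (by omega) (by rwa [h])
    obtain ⟨j, hj, hj1⟩ := hsurj 1 h1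
    rcases Nat.eq_zero_or_pos j with rfl | h
    · exact hj1
    · have := hlt 0 j h hj
      omega
  have h2 : (2 : ℕ) ∉ H := by
    intro h
    have hodd : ∀ i, i < g → f i = 2 * i + 1 := by
      intro i
      induction i with
      | zero => intro _; simpa using hf0
      | succ i ih =>
        intro hi
        have h3 := ih (by omega)
        rcases hstep i hi with h4 | h4
        · refine absurd (mul_mem_of_add_closed h0 hadd h (i + 1)) ?_
          have h5 := hmem (i + 1) hi
          rwa [h4, h3] at h5
        · omega
    have := hodd (g - 1) (by omega)
    omega
  have hf1 : f 1 = 2 := by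
    rcases hstep 0 (by omega) with h | h
    · simpa [hf0] using h
    · exact absurd (hskip 0 2 (by omega) (by omega) (by omega)) h2
  have hupper : ∀ k i, i + k < g → f (i + k) ≤ f i + 2 * k := by
    intro k i
    induction k with
    | zero => intro _; simp
    | succ k ih =>
      intro hk
      have h3 := ih (by omega)
      have h4 := hstep (i + k) hk
      rw [← add_assoc]
      omega
  have htail : ∀ m, m < g → f m + 1 = 2 * m → ∀ i, m ≤ i → i < g → f i + 1 = 2 * i := by
    intro m hm h i hmi hi
    have h3 := hupper (i - m) m (by omega)
    have h4 := hupper (g - 1 - i) i (by omega)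
    rw [Nat.add_sub_cancel' (by omega)] at h3 h4
    omega
  have hs1 : f 2 = 3 ∨ f 2 = 4 := by simpa [hf1] using hstep 1 (by omega)
  rcases hs1 with hf2 | hf2
  · right; right
    have ht := htail 2 (by omega) (by omega)
    ext n
    simp only [Set.mem_union, Set.mem_ofPred_eq]
    constructor
    · intro hn
      by_contra! hcon
      obtain ⟨hc1, hc2⟩ := hcon
      rcases Nat.even_or_odd' n with ⟨k, rfl | rfl⟩
      · by_cases hk : k = 1
        · subst hk; exact h2 hn
        · have := hc1 k hk rfl
          omega
      · by_cases hk : k = 0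
        · subst hk
          exact hmem 0 (by omega) (by rw [hf0]; exact hn)
        · have := ht (k + 1) (by omega) (by omega)
          exact hmem (k + 1) (by omega) (by rwa [show f (k + 1) = 2 * k + 1 by omega])
    · intro hn
      by_contra hnH
      obtain ⟨i, hi, rfl⟩ := hsurj n hnH
      have hcases : i = 0 ∨ i = 1 ∨ 2 ≤ i := by omega
      rcases hcases with rfl | rfl | h
      · rcases hn with ⟨k, hk⟩ | hn <;> omega
      · rcases hn with ⟨k, hk⟩ | hn <;> omega
      · have := ht i h hi
        rcases hn with ⟨k, hk⟩ | hn <;> omega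
  · have h3 : (3 : ℕ) ∈ H := hskip 1 3 (by omega) (by omega) (by simp [hf2])
    have h6 : (6 : ℕ) ∈ H := hadd 3 h3 3 h3
    have h9 : (9 : ℕ) ∈ H := hadd 6 h6 3 h3
    have hg4 : 4 ≤ g := by
      by_contra h
      obtain rfl : g = 3 := by omega
      simp only [Nat.add_one_sub_one] at hlast
      omega
    have hf3 : f 3 = 5 := by
      have h4 : f 3 = 5 ∨ f 3 = 6 := by simpa [hf2] using hstep 2 (by omega)
      rcases h4 with h | h
      · exact h
      · exact absurd h6 (h ▸ hmem 3 (by omega))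
    have ht := htail 3 (by omega) (by omega)
    have hg5 : g < 6 := by
      by_contra h
      have h4 := ht 5 (by omega) (by omega)
      exact hmem 5 (by omega) (by rwa [show f 5 = 9 by omega])
    have hH' : ∀ n, n ∈ H ↔ ∀ i < g, f i ≠ n := by
      intro n
      refine ⟨fun hn i hi h => hmem i hi (h ▸ hn), fun h => ?_⟩
      by_contra hn
      obtain ⟨i, hi, h'⟩ := hsurj n hn
      exact h i hi h'
    obtain rfl | rfl : g = 4 ∨ g = 5 := by omega
    · left
      ext n
      rw [hH']
      simp only [Set.mem_union, Set.mem_insert_iff, Set.mem_singleton_iff, Set.mem_ofPred_eq]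
      constructor
      · intro h
        have := h 0 (by omega)
        have := h 1 (by omega)
        have := h 2 (by omega)
        have := h 3 (by omega)
        omega
      · intro h i hi
        interval_cases i <;> omega
    · right; left
      have hf4 : f 4 = 7 := by simpa using hlast
      ext n
      rw [hH']
      simp only [Set.mem_union, Set.mem_insert_iff, Set.mem_singleton_iff, Set.mem_ofPred_eq]
      constructor
      · intro h
        have := h 0 (by omega)
        have := h 1 (by omega)
        have := h 2 (by omega)
        have := h 3 (by omega)
        have := h 4 (by omega)
        omega
      · intro h i hi
        interval_cases i <;> omega
end

section
/- Let H be a numerical semigroup of genus g ≥ 6 with Frobenius number ℓ_g = 2g - 3. Then H is sparse if and only if H is 1-hyperelliptic (i.e., H has exactly one even gap). -/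
section NumericalSemigroup

variable {H : Set ℕ} {g : ℕ}

theorem lt_card_gaps (hH : IsNumericalSemigroupOfGenus H g) {k : ℕ} (hk : k < g)
    (hf : (Set.ofPred fun n => n ∉ H).Finite) : k < hf.toFinset.card := by
  have h := hH.2.2.2
  rw [← Set.ncard_eq_toFinset_card _ hf]
  change k < Hᶜ.ncard
  omega

theorem nth_gap_notMem (hH : IsNumericalSemigroupOfGenus H g) {k : ℕ} (hk : k < g) :
    Nat.nth (fun n => n ∉ H) k ∉ H :=
  Nat.nth_mem (p := fun n => n ∉ H) k (lt_card_gaps hH hk)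

theorem count_nth_gap [DecidablePred fun n => n ∉ H] (hH : IsNumericalSemigroupOfGenus H g)
    {k : ℕ} (hk : k < g) : Nat.count (fun n => n ∉ H) (Nat.nth (fun n => n ∉ H) k) = k :=
  Nat.count_nth (lt_card_gaps hH hk)

theorem count_gaps_le [DecidablePred fun n => n ∉ H] (hH : IsNumericalSemigroupOfGenus H g)
    (n : ℕ) : Nat.count (fun n => n ∉ H) n ≤ g := by
  have h := Nat.count_le_card (p := fun n => n ∉ H) hH.2.2.1 n
  rw [← Set.ncard_eq_toFinset_card _ hH.2.2.1] at h
  exact h.trans_eq hH.2.2.2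

/-- Every number beyond the last gap lies in the semigroup. -/
theorem mem_of_nth_gap_lt (hH : IsNumericalSemigroupOfGenus H g) (hg : 0 < g) {n : ℕ}
    (hn : Nat.nth (fun n => n ∉ H) (g - 1) < n) : n ∈ H := by
  classical
  by_contra hnH
  have h1 := count_nth_gap hH (Nat.sub_lt hg one_pos)
  have h2 := Nat.count_strict_mono (p := fun n => n ∉ H)
    (nth_gap_notMem hH (Nat.sub_lt hg one_pos)) hn
  have h3 := Nat.count_strict_mono (p := fun n => n ∉ H) hnH (Nat.lt_succ_self n)
  have h4 := count_gaps_le hH (n + 1)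
  rw [Nat.succ_eq_add_one] at h3
  omega

/-- In a sparse semigroup without `1`, two consecutive numbers below the last gap are never both
in the semigroup. -/
theorem IsSparse.notMem_or_succ_notMem (hH : IsNumericalSemigroupOfGenus H g)
    (hs : IsSparse H g) (h1 : 1 ∉ H) {n : ℕ}
    (hn : n < Nat.nth (fun n => n ∉ H) (g - 1)) : n ∉ H ∨ n + 1 ∉ H := by
  classical
  by_contra! hc
  obtain ⟨hn0, hn1⟩ := hc
  have hg : 0 < g := by
    by_contra hg
    have hc := hH.2.2.2
    rw [show g = 0 by omega, Set.ncard_eq_zero hH.2.2.1] at hc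
    exact Set.eq_empty_iff_forall_notMem.1 hc 1 h1
  have hn2 : 2 ≤ n := by
    rcases n with _ | _ | n
    · exact absurd hn1 h1
    · exact absurd hn0 h1
    · omega
  have hpos : 0 < Nat.count (fun n => n ∉ H) n := by
    have h := Nat.count_strict_mono (p := fun n => n ∉ H) h1 (show 1 < n by omega)
    omega
  have hle : Nat.count (fun n => n ∉ H) n ≤ g - 1 := Nat.le_nth_of_count_le hn.le
  obtain ⟨i, hi⟩ : ∃ i, Nat.count (fun n => n ∉ H) n = i := ⟨_, rfl⟩
  rw [hi] at hpos hle
  have hlow : Nat.nth (fun n => n ∉ H) (i - 1) < n := Nat.nth_lt_of_lt_count (by omega)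
  have hmem := nth_gap_notMem hH (show i < g by omega)
  have hcount := count_nth_gap hH (show i < g by omega)
  have hstep := hs i hpos hle
  simp only [gap, Nat.add_sub_cancel] at hstep
  generalize Nat.nth (fun n => n ∉ H) i = y at *
  have hge : n ≤ y := by
    by_contra! hlt
    have h := Nat.count_strict_mono (p := fun n => n ∉ H) hmem hlt
    omega
  have hne : y ≠ n := fun h => hmem (h ▸ hn0)
  have hne' : y ≠ n + 1 := fun h => hmem (h ▸ hn1)
  omega

/-- A semigroup in which every gap before the last one is followed by a gap at distance at most
two is sparse. -/
theorem isSparse_of_forall_gap (hH : IsNumericalSemigroupOfGenus H g)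
    (h : ∀ n ∉ H, n < Nat.nth (fun n => n ∉ H) (g - 1) → n + 1 ∉ H ∨ n + 2 ∉ H) :
    IsSparse H g := by
  classical
  intro i hi hig
  simp only [gap, Nat.add_sub_cancel]
  have hmem := nth_gap_notMem hH (show i - 1 < g by omega)
  have hcount := count_nth_gap hH (show i - 1 < g by omega)
  have hlt : Nat.nth (fun n => n ∉ H) (i - 1) < Nat.nth (fun n => n ∉ H) (g - 1) :=
    Nat.nth_lt_nth' (by omega) (lt_card_gaps hH (by omega))
  have hnext := h _ hmem hlt
  generalize Nat.nth (fun n => n ∉ H) (i - 1) = x at *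
  suffices Nat.nth (fun n => n ∉ H) i < x + 3 by omega
  apply Nat.nth_lt_of_lt_count
  simp only [Nat.count_succ, hcount]
  rcases hnext with hx | hx <;> simp only [hmem, hx, not_false_eq_true, if_true] <;> omega

/-- If consecutive numbers below `F` are never both outside `p`, then any `2 * m` consecutive
numbers up to `F` contribute at least `m` to the count of `p`. -/
theorem count_add_le_count_add_two_mul {p : ℕ → Prop} [DecidablePred p] {F : ℕ}
    (h : ∀ n < F, p n ∨ p (n + 1)) (a m : ℕ) (ham : a + 2 * m ≤ F + 1) :
    Nat.count p a + m ≤ Nat.count p (a + 2 * m) := by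
  induction m with
  | zero => simp
  | succ m ih =>
    have ih := ih (by omega)
    rw [show a + 2 * (m + 1) = a + 2 * m + 1 + 1 by ring, Nat.count_succ, Nat.count_succ]
    rcases h (a + 2 * m) (by omega) with hp | hp <;> rw [if_pos hp] <;> omega

/-- If `p` fails at every second number from `a` on, then `2 * m` consecutive numbers starting
from `a` contribute at most `m` to the count of `p`. -/
theorem count_add_two_mul_le_count_add {p : ℕ → Prop} [DecidablePred p] {a : ℕ}
    (h : ∀ n, ¬ p (a + 2 * n)) (m : ℕ) : Nat.count p (a + 2 * m) ≤ Nat.count p a + m := by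
  induction m with
  | zero => simp
  | succ m ih =>
    rw [show a + 2 * (m + 1) = a + 2 * m + 1 + 1 by ring, Nat.count_succ, Nat.count_succ,
      if_neg (h m)]
    split_ifs <;> omega

theorem mul_mem_of_add_mem (h0 : 0 ∈ H) (hadd : ∀ a ∈ H, ∀ b ∈ H, a + b ∈ H) {a : ℕ}
    (ha : a ∈ H) (n : ℕ) : a * n ∈ H := by
  induction n with
  | zero => simpa using h0
  | succ n ih => exact hadd _ ih _ ha

theorem even_gap_eq_two [DecidablePred fun n => n ∉ H] (h0 : 0 ∈ H)
    (hadd : ∀ a ∈ H, ∀ b ∈ H, a + b ∈ H) {m : ℕ} (h1 : 1 ∉ H) (h2 : 2 ∉ H)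
    (hcount : Nat.count (fun n => n ∉ H) (2 * m + 9) = m + 5)
    (hF : ∀ n, 2 * m + 9 < n → n ∈ H)
    (hsparse : ∀ n < 2 * m + 9, n ∉ H ∨ n + 1 ∉ H) {k : ℕ} (hk : k ∉ H) (hkev : Even k) :
    k = 2 := by
  have hlow := count_add_le_count_add_two_mul hsparse
  by_cases h3 : 3 ∈ H
  · have h6 : 6 ∈ H := hadd 3 h3 3 h3
    have h9 : 9 ∈ H := hadd 6 h6 3 h3
    have h4 := (hsparse 3 (by omega)).resolve_left (not_not.2 h3)
    have h7 := (hsparse 6 (by omega)).resolve_left (not_not.2 h6)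
    have h5 := (hsparse 5 (by omega)).resolve_right (not_not.2 h6)
    have h8 := (hsparse 8 (by omega)).resolve_right (not_not.2 h9)
    have hc9 : Nat.count (fun n => n ∉ H) 9 = 6 := by
      simp [Nat.count_succ, h0, h1, h2, h3, h4, h5, h6, h7, h8]
    have h := hlow 9 m (by omega)
    rw [hc9, Nat.add_comm 9, hcount] at h
    omega
  · by_contra hk2
    obtain ⟨j, rfl⟩ := hkev
    have hj0 : j ≠ 0 := by rintro rfl; exact hk h0
    have hjF : j + j ≤ 2 * m + 9 := not_lt.1 fun h => hk (hF _ h)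
    have hc4 : Nat.count (fun n => n ∉ H) 4 = 3 := by
      simp [Nat.count_succ, h0, h1, h2, h3]
    have ha := hlow 4 (j - 2) (by omega)
    rw [hc4, show 4 + 2 * (j - 2) = j + j by omega] at ha
    have hb := Nat.count_strict_mono (p := fun n => n ∉ H) hk (Nat.lt_succ_self _)
    have hc := hlow (j + j + 1) (m + 4 - j) (by omega)
    rw [show j + j + 1 + 2 * (m + 4 - j) = 2 * m + 9 by omega, hcount] at hc
    rw [Nat.succ_eq_add_one] at hb
    omega

theorem odd_notMem [DecidablePred fun n => n ∉ H] (h0 : 0 ∈ H)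
    (hadd : ∀ a ∈ H, ∀ b ∈ H, a + b ∈ H) {m : ℕ}
    (hcount : Nat.count (fun n => n ∉ H) (2 * m + 9) = m + 5) (hF : 2 * m + 9 ∉ H)
    (heven : ∀ n, n ≠ 1 → 2 * n ∈ H) {j : ℕ} (hj : j ≤ m + 4) : 2 * j + 1 ∉ H := by
  intro hmem
  by_cases hjm : j = m + 3
  · subst hjm
    have hc4 : Nat.count (fun n => n ∉ H) 4 ≤ 3 := by
      simp only [Nat.count_succ, Nat.count_zero, h0, not_true_eq_false, if_false]
      split_ifs <;> omega
    have h := count_add_two_mul_le_count_add (p := fun n => n ∉ H) (a := 4)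
      (fun n => not_not.2 <| by
        rw [show 4 + 2 * n = 2 * (n + 2) by ring]; exact heven _ (by omega)) (m + 1)
    have h6 : 4 + 2 * (m + 1) ∈ H := by
      rw [show 4 + 2 * (m + 1) = 2 * (m + 3) by ring]; exact heven _ (by omega)
    have h7 : 4 + 2 * (m + 1) + 1 ∈ H := by
      rwa [show 4 + 2 * (m + 1) + 1 = 2 * (m + 3) + 1 by ring]
    have h8 : 4 + 2 * (m + 1) + 1 + 1 ∈ H := by
      rw [show 4 + 2 * (m + 1) + 1 + 1 = 2 * (m + 4) by ring]; exact heven _ (by omega)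
    rw [show 2 * m + 9 = 4 + 2 * (m + 1) + 1 + 1 + 1 by ring, Nat.count_succ, Nat.count_succ,
      Nat.count_succ, if_neg (not_not.2 h6), if_neg (not_not.2 h7), if_neg (not_not.2 h8)] at hcount
    omega
  · have h := hadd _ hmem _ (heven (m + 4 - j) (by omega))
    rw [show 2 * j + 1 + 2 * (m + 4 - j) = 2 * m + 9 by omega] at h
    exact hF h

theorem two_notMem_of_count [DecidablePred fun n => n ∉ H] (h0 : 0 ∈ H)
    (hadd : ∀ a ∈ H, ∀ b ∈ H, a + b ∈ H) {m : ℕ}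
    (hcount : Nat.count (fun n => n ∉ H) (2 * m + 9) = m + 5) : 2 ∉ H := by
  intro h2
  have h := count_add_two_mul_le_count_add (p := fun n => n ∉ H) (a := 0)
    (fun n => not_not.2 <| by simpa using mul_mem_of_add_mem h0 hadd h2 n) (m + 4)
  have h8 : 0 + 2 * (m + 4) ∈ H := by simpa using mul_mem_of_add_mem h0 hadd h2 (m + 4)
  rw [show 2 * m + 9 = 0 + 2 * (m + 4) + 1 by ring, Nat.count_succ,
    if_neg (not_not.2 h8)] at hcount
  rw [Nat.count_zero] at h
  omega

end NumericalSemigroup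

/-- **Corollary.** Let `H` be a numerical semigroup of genus `g ≥ 6` with Frobenius
number `ℓ_g = 2g - 3`. Then `H` is sparse if and only if `H` is `1`-hyperelliptic
(i.e. `H` has exactly one even gap). -/
theorem sparse_iff_one_hyperelliptic (H : Set ℕ) (g : ℕ) (hg : 6 ≤ g)
    (hH : IsNumericalSemigroupOfGenus H g) (hF : gap H g = 2 * g - 3) :
    IsSparse H g ↔ {n : ℕ | n ∉ H ∧ Even n}.ncard = 1 := by
  classical
  obtain ⟨m, rfl⟩ : ∃ m, g = m + 6 := ⟨g - 6, by omega⟩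
  obtain ⟨h0, hadd, -, -⟩ := id hH
  have hFnth : Nat.nth (fun n => n ∉ H) (m + 6 - 1) = 2 * m + 9 := by
    rw [gap] at hF
    omega
  have hFmem := nth_gap_notMem hH (show m + 6 - 1 < m + 6 by omega)
  have hcount := count_nth_gap hH (show m + 6 - 1 < m + 6 by omega)
  rw [hFnth] at hFmem hcount
  replace hcount : Nat.count (fun n => n ∉ H) (2 * m + 9) = m + 5 := hcount
  have h1 : 1 ∉ H := fun h => hFmem (by simpa using mul_mem_of_add_mem h0 hadd h (2 * m + 9))
  have h2 : 2 ∉ H := two_notMem_of_count h0 hadd hcount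
  constructor
  · intro hs
    rw [Set.ncard_eq_one]
    refine ⟨2, Set.eq_singleton_iff_unique_mem.2 ⟨⟨h2, even_two⟩, fun k hk => ?_⟩⟩
    refine even_gap_eq_two h0 hadd h1 h2 hcount ?_ ?_ hk.1 hk.2
    · exact fun n hn => mem_of_nth_gap_lt hH (by omega) (hFnth ▸ hn)
    · exact fun n hn => hs.notMem_or_succ_notMem hH h1 (hFnth ▸ hn)
  · intro hone
    obtain ⟨a, ha⟩ := Set.ncard_eq_one.1 hone
    have h2a : (2 : ℕ) = a := (Set.ext_iff.1 ha 2).1 ⟨h2, even_two⟩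
    have heven : ∀ n, n ≠ 1 → 2 * n ∈ H := by
      intro n hn
      by_contra hnH
      have h : 2 * n = a := (Set.ext_iff.1 ha (2 * n)).1 ⟨hnH, even_two_mul n⟩
      omega
    refine isSparse_of_forall_gap hH fun n hn hlt => ?_
    rw [hFnth] at hlt
    rcases Nat.even_or_odd' n with ⟨j, rfl | rfl⟩
    · exact Or.inl (odd_notMem h0 hadd hcount hFmem heven (by omega))
    · exact Or.inr (odd_notMem (j := j + 1) h0 hadd hcount hFmem heven (by omega))
end

section
/- If H is a limit sparse numerical semigroup with even Frobenius number ℓ_g = 2g - 2r (so g = 4r - 1 and ℓ_g = 6r - 2), then 4 ∉ H. -/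
open Classical in
/-- A sparse numerical semigroup has no two consecutive elements below its Frobenius number. -/
theorem IsSparse.not_mem_succ {H : Set ℕ} {g x : ℕ} (hH : IsNumericalSemigroupOfGenus H g)
    (hs : IsSparse H g) (h1 : 1 ∉ H) (hx : x ∈ H) (hxg : x + 1 < gap H g) : x + 1 ∉ H := by
  intro hx'
  obtain ⟨-, -, hfin, hcard⟩ := hH
  have hc : hfin.toFinset.card = g := by rw [← hcard, Set.ncard_eq_toFinset_card _ hfin]
  have hx2 : 2 ≤ x := by
    rcases x with _ | _ | x
    · exact absurd hx' h1
    · exact absurd hx h1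
    · omega
  set p : ℕ → Prop := fun n => n ∉ H with hp
  set i := Nat.count p x with hi
  have hipos : 0 < i := by
    have h12 : Nat.count p 2 ≤ i := Nat.count_monotone p hx2
    have : Nat.count p 2 = Nat.count p 1 + 1 := by
      rw [Nat.count_succ, if_pos h1]
    omega
  have hig : i ≤ g - 1 := by
    by_contra! hlt
    have : Nat.nth p (g - 1) < x := Nat.nth_lt_of_lt_count hlt
    simp only [gap, ← hp] at hxg
    omega
  have hlow : Nat.nth p (i - 1) < x := Nat.nth_lt_of_lt_count (by omega)
  have hil : i < hfin.toFinset.card := by omega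
  have hmem : p (Nat.nth p i) := Nat.nth_mem_of_lt_card hfin hil
  have hge : x ≤ Nat.nth p i := by
    by_contra! hlt
    have h := (Nat.count_strict_mono hmem hlt)
    rw [Nat.count_nth_of_lt_card_finite hfin hil] at h
    omega
  have hne : Nat.nth p i ≠ x := fun h => hmem (h ▸ hx)
  have hne' : Nat.nth p i ≠ x + 1 := fun h => hmem (h ▸ hx')
  have := hs i hipos hig
  simp only [gap, Nat.add_sub_cancel, ← hp] at this
  omega

/-- In a sparse semigroup every leap is single or double. -/
theorem IsSparse.leap {H : Set ℕ} {g i : ℕ} (hH : IsNumericalSemigroupOfGenus H g)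
    (hs : IsSparse H g) (hi : 1 ≤ i) (hig : i ≤ g - 1) :
    gap H (i + 1) = gap H i + 1 ∨ gap H (i + 1) = gap H i + 2 := by
  obtain ⟨-, -, hfin, hcard⟩ := hH
  have hc : hfin.toFinset.card = g := by rw [← hcard, Set.ncard_eq_toFinset_card _ hfin]
  have hlt : gap H i < gap H (i + 1) :=
    Nat.nth_lt_nth_of_lt_card hfin (by omega) (by omega)
  have := hs i hi hig
  omega

/-- The leaps of a sparse semigroup of genus `g` are `g - 1` in number. -/
theorem IsSparse.numSingle_add_numDouble {H : Set ℕ} {g : ℕ}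
    (hH : IsNumericalSemigroupOfGenus H g) (hs : IsSparse H g) :
    numSingle H g + numDouble H g = g - 1 := by
  have hunion : {i | 1 ≤ i ∧ i ≤ g - 1 ∧ gap H (i + 1) - gap H i = 1} ∪
      {i | 1 ≤ i ∧ i ≤ g - 1 ∧ gap H (i + 1) - gap H i = 2} = Set.Icc 1 (g - 1) := by
    ext i
    simp only [Set.mem_union, Set.mem_ofPred_eq, Set.mem_Icc]
    constructor
    · rintro (h | h) <;> exact ⟨h.1, h.2.1⟩
    · rintro ⟨h, h'⟩
      rcases hs.leap hH h h' with h2 | h2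
      · exact Or.inl ⟨h, h', by omega⟩
      · exact Or.inr ⟨h, h', by omega⟩
  have hfin := Set.finite_Icc 1 (g - 1)
  rw [← hunion, Set.finite_union] at hfin
  rw [numSingle, numDouble, ← Set.ncard_union_eq _ hfin.1 hfin.2, hunion,
    ← Finset.coe_Icc, Set.ncard_coe_finset, Nat.card_Icc, Nat.add_sub_cancel]
  rw [Set.disjoint_left]
  rintro i ⟨-, -, h⟩ ⟨-, -, h'⟩
  omega

/-- The Frobenius number exceeds the first gap by the total length of the leaps. -/
theorem IsSparse.gap_eq {H : Set ℕ} {g : ℕ} (hg : 1 ≤ g)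
    (hH : IsNumericalSemigroupOfGenus H g) (hs : IsSparse H g) :
    gap H g = gap H 1 + (g - 1) + numDouble H g := by
  have key : ∀ n, n ≤ g - 1 → gap H (n + 1) =
      gap H 1 + n + ((Finset.Icc 1 n).filter fun i => gap H (i + 1) - gap H i = 2).card := by
    intro n
    induction n with
    | zero => simp
    | succ n ih =>
      intro hn
      rw [← Finset.insert_Icc_right_eq_Icc_add_one (by omega : 1 ≤ n + 1), Finset.filter_insert]
      have ih := ih (by omega)
      rcases hs.leap hH (by omega : 1 ≤ n + 1) hn with h | h
      · rw [if_neg (by omega)]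
        omega
      · rw [if_pos (by omega), Finset.card_insert_of_notMem (by simp)]
        omega
  have h := key (g - 1) le_rfl
  rw [Nat.sub_add_cancel hg] at h
  rw [h, numDouble, ← Set.ncard_coe_finset]
  congr 2
  ext i
  simp [and_assoc]

open Classical in
/-- **Lemma.** If `H` is a limit sparse numerical semigroup with even Frobenius
number `ℓ_g = 2g - 2r`, then `4 ∉ H`. -/
theorem four_is_gap (H : Set ℕ) (g r : ℕ) (hg : 1 < g)
    (hH : IsNumericalSemigroupOfGenus H g) (hs : IsSparse H g)
    (hlim : numSingle H g = numDouble H g)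
    (hF : gap H g = 2 * g - 2 * r) :
    4 ∉ H := by
  intro h4
  have hSD := hs.numSingle_add_numDouble hH
  have hL := hs.gap_eq hg.le hH
  have hcons := fun x => hs.not_mem_succ (x := x) hH
  obtain ⟨h0, hadd, hfin, hcard⟩ := hH
  have hc : hfin.toFinset.card = g := by rw [← hcard, Set.ncard_eq_toFinset_card _ hfin]
  have hmul : ∀ a ∈ H, ∀ n, n * a ∈ H := by
    intro a ha n
    induction n with
    | zero => simpa using h0
    | succ n ih => rw [Nat.succ_mul]; exact hadd _ ih _ ha
  have h1 : 1 ∉ H := by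
    intro h1
    have : Hᶜ = ∅ := by
      rw [Set.compl_empty_iff]
      exact Set.eq_univ_of_forall fun n => by simpa using hmul 1 h1 n
    rw [this, Set.ncard_empty] at hcard
    omega
  replace hcons := fun x => hcons x h1
  set p : ℕ → Prop := fun n => n ∉ H with hp
  have hgap1 : gap H 1 = 1 := by
    have h := Nat.nth_count (p := p) h1
    rwa [Nat.count_succ, Nat.count_zero, if_neg (fun h => h h0)] at h
  have hLgap : gap H g ∉ H := Nat.nth_mem_of_lt_card hfin (by omega : g - 1 < _)
  have hcount : Nat.count p (gap H g) = g - 1 :=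
    Nat.count_nth_of_lt_card_finite hfin (by omega)
  have hmul4 : ∀ n, n % 4 = 0 → n ∈ H := fun n hn => by
    have := hmul 4 h4 (n / 4)
    rwa [Nat.div_mul_cancel (Nat.dvd_of_mod_eq_zero hn)] at this
  have hL4 : gap H g % 4 = 2 := by
    have : gap H g % 4 ≠ 0 := fun h => hLgap (hmul4 _ h)
    omega
  have hgaps : ∀ n < gap H g, n % 4 ≠ 0 → n ∉ H := by
    intro n hn hn4 hnH
    rcases (by omega : n % 4 = 1 ∨ n % 4 = 2 ∨ n % 4 = 3) with h | h | h
    · have := hcons (n - 1) (hmul4 _ (by omega)) (by omega)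
      rw [Nat.sub_add_cancel (by omega)] at this
      exact this hnH
    · have := hadd _ hnH _ (hmul4 (gap H g - n) (by omega))
      rw [Nat.add_sub_cancel' hn.le] at this
      exact hLgap this
    · exact hcons n hnH (by omega) (hmul4 _ (by omega))
  have hcnt : ∀ m, 4 * m ≤ gap H g → 3 * m ≤ Nat.count p (4 * m) := by
    intro m
    induction m with
    | zero => simp
    | succ m ih =>
      intro hm
      have := ih (by omega)
      rw [show 4 * (m + 1) = 4 * m + 1 + 1 + 1 + 1 by ring, Nat.count_succ, Nat.count_succ,
        Nat.count_succ, Nat.count_succ,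
        if_pos (show p (4 * m + 1) from hgaps _ (by omega) (by omega)),
        if_pos (show p (4 * m + 1 + 1) from hgaps _ (by omega) (by omega)),
        if_pos (show p (4 * m + 1 + 1 + 1) from hgaps _ (by omega) (by omega))]
      omega
  have hfinal : Nat.count p (gap H g) = Nat.count p (4 * (gap H g / 4)) + 1 := by
    conv_lhs => rw [show gap H g = 4 * (gap H g / 4) + 1 + 1 by omega]
    rw [Nat.count_succ, Nat.count_succ, if_neg (fun h => h (hmul4 _ (by omega))),
      if_pos (show p _ from hgaps _ (by omega) (by omega))]
  have := hcnt (gap H g / 4) (by omega)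
  omega
end

section
/- If H is a limit sparse numerical semigroup with even Frobenius number ℓ_g = 2g - 2r, then H is an Arf semigroup. -/
/-- `H` is an Arf semigroup: `a + b - c ∈ H` for all `a ≥ b ≥ c` in `H`. -/
def IsArf (H : Set ℕ) : Prop :=
  ∀ a ∈ H, ∀ b ∈ H, ∀ c ∈ H, c ≤ b → b ≤ a → a + b - c ∈ H

open Finset in
/-- If every `j ∈ [1, i]` is sent into `[2, 2i]` by a strictly increasing function with values in
`U`, and `U` contains two further points outside `[2, 2i]`, then `U` has more than `i + 1` points. -/
lemma add_two_le_card_of_strictMonoOn (U : Finset ℕ) (i b : ℕ) (f : ℕ → ℕ)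
    (hf : ∀ j ∈ Icc 1 i, f j ∈ U ∧ 2 ≤ f j ∧ f j ≤ 2 * i)
    (hmono : ∀ j ∈ Icc 1 i, ∀ k ∈ Icc 1 i, j < k → f j < f k)
    (h1 : 1 ∈ U) (hb : b ∈ U) (hib : 2 * i < b) (hb1 : b ≠ 1) : i + 2 ≤ U.card := by
  have hinj : Set.InjOn f (Icc 1 i : Finset ℕ) := by
    intro j hj k hk hjk
    rcases lt_trichotomy j k with h | h | h
    · have := hmono j hj k hk h
      omega
    · exact h
    · have := hmono k hk j hj h
      omega
  have hc : ((Icc 1 i).image f).card = i := by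
    rw [card_image_of_injOn hinj]
    simp
  have hb' : b ∉ (Icc 1 i).image f := by
    intro h
    obtain ⟨j, hj, rfl⟩ := mem_image.1 h
    have := hf j hj
    omega
  have h1' : 1 ∉ insert b ((Icc 1 i).image f) := by
    intro h
    rcases mem_insert.1 h with h | h
    · exact hb1 h.symm
    · obtain ⟨j, hj, hj1⟩ := mem_image.1 h
      have := hf j hj
      omega
  have hsub : insert 1 (insert b ((Icc 1 i).image f)) ⊆ U := by
    intro x hx
    rcases mem_insert.1 hx with rfl | hx
    · exact h1
    rcases mem_insert.1 hx with rfl | hx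
    · exact hb
    obtain ⟨j, hj, rfl⟩ := mem_image.1 hx
    exact (hf j hj).1
  have := card_le_card hsub
  rw [card_insert_of_notMem h1', card_insert_of_notMem hb', hc] at this
  exact this

open Finset in
/-- If `f` and `f - 1` are gaps of a semigroup `H` without consecutive elements below `f`, then
the sets `A`, `A + 1` and `f - A`, where `A = H ∩ [1, f]`, are disjoint subsets of `[1, f]`. -/
lemma three_mul_card_add_card_uncovered (H : Set ℕ) [DecidablePred (· ∈ H)] (f : ℕ)
    (hadd : ∀ a ∈ H, ∀ b ∈ H, a + b ∈ H) (hf : f ∉ H) (hf1 : f - 1 ∉ H)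
    (hcons : ∀ x ∈ H, x < f → x + 1 ∉ H) :
    3 * #{x ∈ Icc 1 f | x ∈ H} +
      #{x ∈ Icc 1 f | x ∉ H ∧ (x - 1 ∉ H ∨ x = 1) ∧ (f - x ∉ H ∨ x = f)} = f := by
  set A : Finset ℕ := {x ∈ Icc 1 f | x ∈ H} with hA
  set U : Finset ℕ := {x ∈ Icc 1 f | x ∉ H ∧ (x - 1 ∉ H ∨ x = 1) ∧ (f - x ∉ H ∨ x = f)} with hU
  have memA : ∀ x, x ∈ A ↔ (1 ≤ x ∧ x ≤ f) ∧ x ∈ H := by simp [hA]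
  have ltA : ∀ x ∈ A, 1 ≤ x ∧ x < f ∧ x ∈ H := by
    intro x hx
    obtain ⟨⟨h1, h2⟩, h3⟩ := (memA x).1 hx
    refine ⟨h1, lt_of_le_of_ne h2 ?_, h3⟩
    rintro rfl
    exact hf h3
  have cB : (A.image (· + 1)).card = A.card :=
    card_image_of_injective _ (add_left_injective 1)
  have cC : (A.image (f - ·)).card = A.card := by
    refine card_image_of_injOn ?_
    intro x hx y hy hxy
    have := ltA x hx
    have := ltA y hy
    simp only at hxy
    omega
  have dAB : Disjoint A (A.image (· + 1)) := by
    rw [disjoint_left]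
    intro x hx hx'
    obtain ⟨y, hy, rfl⟩ := mem_image.1 hx'
    exact hcons y (ltA y hy).2.2 (ltA y hy).2.1 (ltA _ hx).2.2
  have dC : Disjoint (A ∪ A.image (· + 1)) (A.image (f - ·)) := by
    rw [disjoint_left]
    intro x hx hx'
    obtain ⟨z, hz, rfl⟩ := mem_image.1 hx'
    have h3 := ltA z hz
    rcases mem_union.1 hx with h | h
    · have := hadd _ (ltA _ h).2.2 z h3.2.2
      rw [Nat.sub_add_cancel h3.2.1.le] at this
      exact hf this
    · obtain ⟨y, hy, hyz⟩ := mem_image.1 h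
      have := hadd y (ltA y hy).2.2 z h3.2.2
      rw [show y + z = f - 1 by omega] at this
      exact hf1 this
  have dU : Disjoint (A ∪ A.image (· + 1) ∪ A.image (f - ·)) U := by
    rw [disjoint_left]
    intro x hx hxU
    simp only [hU, mem_filter, mem_Icc] at hxU
    obtain ⟨hx1, hxH, hxp, hxf⟩ := hxU
    rcases mem_union.1 hx with h | h
    · rcases mem_union.1 h with h | h
      · exact hxH (ltA x h).2.2
      · obtain ⟨y, hy, rfl⟩ := mem_image.1 h
        have := ltA y hy
        rcases hxp with h | h
        · exact h (by simpa using this.2.2)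
        · omega
    · obtain ⟨y, hy, rfl⟩ := mem_image.1 h
      have := ltA y hy
      rcases hxf with h | h
      · apply h
        rw [Nat.sub_sub_self this.2.1.le]
        exact this.2.2
      · omega
  have hun : A ∪ A.image (· + 1) ∪ A.image (f - ·) ∪ U = Icc 1 f := by
    ext x
    simp only [mem_union, mem_image]
    constructor
    · rintro (((h | ⟨y, hy, rfl⟩) | ⟨y, hy, rfl⟩) | h)
      · have := ltA x h
        simp only [mem_Icc]
        omega
      · have := ltA y hy
        simp only [mem_Icc]
        omega
      · have := ltA y hy
        simp only [mem_Icc]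
        omega
      · exact (mem_filter.1 h).1
    · intro hx
      have hx' := mem_Icc.1 hx
      by_cases h1 : x ∈ H
      · exact Or.inl (Or.inl (Or.inl ((memA x).2 ⟨hx', h1⟩)))
      by_cases h2 : x - 1 ∈ H ∧ x ≠ 1
      · exact Or.inl (Or.inl (Or.inr ⟨x - 1, (memA _).2 ⟨by omega, h2.1⟩, by omega⟩))
      by_cases h3 : f - x ∈ H ∧ x ≠ f
      · exact Or.inl (Or.inr ⟨f - x, (memA _).2 ⟨by omega, h3.1⟩, by omega⟩)
      · refine Or.inr (mem_filter.2 ⟨hx, h1, ?_, ?_⟩) <;> tauto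
  have := congrArg card hun
  rw [card_union_of_disjoint dU, card_union_of_disjoint dC, card_union_of_disjoint dAB, cB, cC,
    Nat.card_Icc] at this
  omega

/-- A semigroup with even Frobenius number `F` whose elements `F - 1, F - 3, …, F - 2i + 1` all
belong to it, and without consecutive elements below `F`, has no nonzero element up to `2i`. -/
lemma notMem_of_odd_run (H : Set ℕ) (F i : ℕ) (h0 : 0 ∈ H)
    (hadd : ∀ a ∈ H, ∀ b ∈ H, a + b ∈ H) (hF : F ∉ H) (hFe : Even F)
    (hcons : ∀ x ∈ H, x < F → x + 1 ∉ H) (hi : 2 * i < F)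
    (hrun : ∀ l < i, F - (2 * l + 1) ∈ H) : ∀ x, 1 ≤ x → x ≤ 2 * i → x ∉ H := by
  intro x hx1 hxi hx
  rcases Nat.even_or_odd' x with ⟨c, rfl | rfl⟩
  · have hmul : ∀ k, 2 * c * k ∈ H := by
      intro k
      induction k with
      | zero => simpa using h0
      | succ k ih => exact hadd _ ih _ hx
    have h1 := hmul (F / (2 * c))
    have h2 := Nat.div_add_mod F (2 * c)
    have h3 := Nat.mod_lt F (show 2 * c > 0 by omega)
    obtain ⟨d, hd⟩ := hFe
    have h4 : F % (2 * c) % 2 = 0 := by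
      rw [Nat.mod_mul_right_mod]
      omega
    set q := 2 * c * (F / (2 * c))
    by_cases h5 : F % (2 * c) = 0
    · exact hF (by rwa [show F = q by omega])
    · have h6 := hrun (F % (2 * c) / 2 - 1) (by omega)
      rw [show F - (2 * (F % (2 * c) / 2 - 1) + 1) = q + 1 by omega] at h6
      exact hcons q h1 (by omega) h6
  · have := hadd _ hx _ (hrun c (by omega))
    rw [show 2 * c + 1 + (F - (2 * c + 1)) = F by omega] at this
    exact hF this

open Finset in
/-- A semigroup with even Frobenius number `F`, without consecutive elements below `F` and with
`(F - 1) / 3` nonzero elements below `F`, contains `3`. -/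
lemma three_mem_of_card (H : Set ℕ) [DecidablePred (· ∈ H)] (F : ℕ) (h0 : 0 ∈ H)
    (hadd : ∀ a ∈ H, ∀ b ∈ H, a + b ∈ H) (hF : F ∉ H) (hFe : Even F)
    (hcons : ∀ x ∈ H, x < F → x + 1 ∉ H) (hcard : 3 * #{x ∈ Icc 1 F | x ∈ H} + 1 = F) :
    3 ∈ H := by
  have hF0 : 0 < F := by omega
  have h1H : 1 ∉ H := by simpa using hcons 0 h0 hF0
  obtain ⟨d, hd⟩ := hFe
  have hex : ∃ i, F - (2 * i + 1) ∉ H :=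
    ⟨d - 1, by rwa [show F - (2 * (d - 1) + 1) = 1 by omega]⟩
  classical
  obtain ⟨i, hi, hrun⟩ : ∃ i, F - (2 * i + 1) ∉ H ∧ ∀ l < i, F - (2 * l + 1) ∈ H :=
    ⟨Nat.find hex, Nat.find_spec hex, fun l hl => not_not.1 (Nat.find_min hex hl)⟩
  have hiF : 2 * i + 2 ≤ F := by
    by_contra h
    have := hrun (d - 1) (by omega)
    rw [show F - (2 * (d - 1) + 1) = 1 by omega] at this
    exact h1H this
  obtain ⟨f, hf⟩ : ∃ f, F = f + 2 * i := ⟨F - 2 * i, by omega⟩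
  have hlow := notMem_of_odd_run H F i h0 hadd hF ⟨d, hd⟩ hcons (by omega) hrun
  have hrun' : ∀ l, 1 ≤ l → l ≤ i → f + 2 * l - 1 ∈ H := by
    intro l h1 h2
    have := hrun (i - l) (by omega)
    rwa [show F - (2 * (i - l) + 1) = f + 2 * l - 1 by omega] at this
  have heven : ∀ l ≤ i, f + 2 * l ∉ H := by
    intro l hl
    rcases Nat.eq_or_lt_of_le hl with rfl | hl
    · rwa [← hf]
    · intro h
      apply hcons _ h (by omega)
      have := hrun' (l + 1) (by omega) (by omega)
      rwa [show f + 2 * (l + 1) - 1 = f + 2 * l + 1 by omega] at this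
  have hfH : f ∉ H := heven 0 (by omega)
  have hf1 : f - 1 ∉ H := by rwa [show f - 1 = F - (2 * i + 1) by omega]
  have hcount := three_mul_card_add_card_uncovered H f hadd hfH hf1
    (fun x hx hxf => hcons x hx (by omega))
  have hsplit : #{x ∈ Icc 1 F | x ∈ H} ≤ #{x ∈ Icc 1 f | x ∈ H} + i := by
    have hsub : ({x ∈ Icc 1 F | x ∈ H} : Finset ℕ) ⊆
        {x ∈ Icc 1 f | x ∈ H} ∪ (range i).image (fun l => f + 2 * l + 1) := by
      intro x hx
      simp only [mem_filter, mem_Icc] at hx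
      simp only [mem_union, mem_filter, mem_Icc, mem_image, mem_range]
      by_cases hxf : x ≤ f
      · exact Or.inl ⟨⟨hx.1.1, hxf⟩, hx.2⟩
      · right
        rcases Nat.even_or_odd' (x - f) with ⟨c, hc | hc⟩
        · exact absurd hx.2 (by rw [show x = f + 2 * c by omega]; exact heven c (by omega))
        · exact ⟨c, by omega, by omega⟩
    calc _ ≤ _ := card_le_card hsub
      _ ≤ _ := card_union_le _ _
      _ ≤ _ := by
        gcongr
        exact card_image_le.trans (by simp)
  set U : Finset ℕ := {x ∈ Icc 1 f | x ∉ H ∧ (x - 1 ∉ H ∨ x = 1) ∧ (f - x ∉ H ∨ x = f)} with hU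
  have hUcard : U.card ≤ i + 1 := by omega
  have memU : ∀ x, x ∈ U ↔ (1 ≤ x ∧ x ≤ f) ∧ x ∉ H ∧ (x - 1 ∉ H ∨ x = 1) ∧
      (f - x ∉ H ∨ x = f) := by simp [hU]
  have h1U : 1 ∈ U := (memU 1).2 ⟨by omega, h1H, Or.inr rfl, Or.inl hf1⟩
  have hfU : f ∈ U := (memU f).2 ⟨by omega, hfH, Or.inl hf1, Or.inr rfl⟩
  have hi0 : i ≠ 0 := by
    rintro rfl
    have : ({1, f} : Finset ℕ) ⊆ U := by
      intro x hx
      simp only [mem_insert, mem_singleton] at hx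
      rcases hx with rfl | rfl <;> assumption
    have := card_le_card this
    rw [card_pair (by omega)] at this
    omega
  have hlowU : ∀ x, 1 ≤ x → x ≤ 2 * i → x ≤ f → (f - x ∉ H ∨ x = f) → x ∈ U := by
    intro x h1 h2 h3 h4
    refine (memU x).2 ⟨⟨h1, h3⟩, hlow x h1 h2, ?_, h4⟩
    by_cases hx : x = 1
    · exact Or.inr hx
    · exact Or.inl (hlow _ (by omega) (by omega))
  have hfi : 2 * i ≤ f := by
    by_contra h
    have := hrun' 1 le_rfl (by omega)
    exact hlow _ (by omega) (by omega) this
  rcases Nat.eq_or_lt_of_le hfi with hfi | hfi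
  · have hsub : Icc 1 f ⊆ U := by
      intro x hx
      rw [mem_Icc] at hx
      refine hlowU x hx.1 (by omega) hx.2 ?_
      by_cases hxf : x = f
      · exact Or.inr hxf
      · exact Or.inl (hlow _ (by omega) (by omega))
    have := card_le_card hsub
    rw [Nat.card_Icc] at this
    have := hrun' 1 le_rfl (by omega)
    rwa [show f + 2 * 1 - 1 = 3 by omega] at this
  have hpair : ∀ x, 1 ≤ x → x + 1 ≤ 2 * i → x ∈ U ∨ x + 1 ∈ U := by
    intro x h1 h2
    by_cases h : f - (x + 1) ∈ H
    · refine Or.inl (hlowU x h1 (by omega) (by omega) (Or.inl ?_))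
      have := hcons _ h (by omega)
      rwa [show f - (x + 1) + 1 = f - x by omega] at this
    · exact Or.inr (hlowU _ (by omega) h2 (by omega) (Or.inl h))
  have hevens : ∀ l, 1 ≤ l → l ≤ i → f - 2 * l ∈ H := by
    intro l hl1 hli
    by_contra h
    have hlU := hlowU (2 * l) (by omega) (by omega) (by omega) (Or.inl h)
    have hg : ∀ j, ∃ y, j ∈ Icc 1 i → y ∈ U ∧ (j < l → y = 2 * j ∨ y = 2 * j + 1) ∧
        (j = l → y = 2 * j) ∧ (l < j → y = 2 * j - 1 ∨ y = 2 * j) := by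
      intro j
      by_cases hj : j ∈ Icc 1 i
      · rw [mem_Icc] at hj
        rcases lt_trichotomy j l with h | h | h
        · rcases hpair (2 * j) (by omega) (by omega) with h' | h'
          · exact ⟨2 * j, fun _ => ⟨h', by omega, by omega, by omega⟩⟩
          · exact ⟨2 * j + 1, fun _ => ⟨h', by omega, by omega, by omega⟩⟩
        · exact ⟨2 * j, fun _ => ⟨by rwa [h], by omega, by omega, by omega⟩⟩
        · rcases hpair (2 * j - 1) (by omega) (by omega) with h' | h'
          · exact ⟨2 * j - 1, fun _ => ⟨h', by omega, by omega, by omega⟩⟩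
          · rw [show 2 * j - 1 + 1 = 2 * j by omega] at h'
            exact ⟨2 * j, fun _ => ⟨h', by omega, by omega, by omega⟩⟩
      · exact ⟨0, fun h => absurd h hj⟩
    choose g hg using hg
    have := add_two_le_card_of_strictMonoOn U i f g
      (fun j hj => by
        have h2 := hg j hj
        rw [mem_Icc] at hj
        exact ⟨h2.1, by omega, by omega⟩)
      (fun j hj k hk hjk => by
        have h2 := hg j hj
        have h3 := hg k hk
        rw [mem_Icc] at hj hk
        omega) h1U hfU hfi (by omega)
    omega
  have hcover : ∀ x, 2 * i < x → x < f → x ∈ H ∨ x - 1 ∈ H ∨ f - x ∈ H := by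
    intro x hxi hxf
    by_contra! h
    have hxU : x ∈ U := (memU x).2 ⟨by omega, h.1, Or.inl h.2.1, Or.inl h.2.2⟩
    have hoU : ∀ j ∈ range i, 2 * j + 1 ∈ U := by
      intro j hj
      rw [mem_range] at hj
      refine hlowU _ (by omega) (by omega) (by omega) (Or.inl fun h' => ?_)
      rcases Nat.eq_zero_or_pos j with rfl | hj0
      · exact hf1 (by simpa using h')
      · apply hcons _ h' (by omega)
        have := hevens j hj0 hj.le
        rwa [show f - (2 * j + 1) + 1 = f - 2 * j by omega]
    have hsub : insert x (insert f ((range i).image (fun j => 2 * j + 1))) ⊆ U := by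
      intro y hy
      simp only [mem_insert, mem_image] at hy
      rcases hy with rfl | rfl | ⟨j, hj, rfl⟩
      · exact hxU
      · exact hfU
      · exact hoU j hj
    have hc := card_le_card hsub
    rw [card_insert_of_notMem, card_insert_of_notMem, card_image_of_injective, card_range] at hc
    · omega
    · intro a b hab
      simp only at hab
      omega
    · simp only [mem_image, mem_range, not_exists, not_and]
      intro j hj
      omega
    · simp only [mem_insert, mem_image, mem_range, not_or, not_exists, not_and]
      exact ⟨by omega, fun j hj => by omega⟩
  have hlast := hevens i (by omega) le_rfl
  have hlast' : 2 * i < f - 2 * i := by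
    by_contra h
    exact hlow _ (by omega) (by omega) hlast
  have hm : 2 * i + 1 ∈ H := by
    rcases hcover (2 * i + 1) (by omega) (by omega) with h | h | h
    · exact h
    · exact absurd h (hlow _ (by omega) (by omega))
    · refine absurd ?_ (hcons _ h (by omega))
      rwa [show f - (2 * i + 1) + 1 = f - 2 * i by omega]
  by_cases hi1 : i = 1
  · subst hi1
    exact hm
  exfalso
  have hne : f - 2 * i ≠ 2 * i + 2 := by
    intro h
    rw [h] at hlast
    exact hcons _ hm (by omega) hlast
  have hrow : ∀ l < i, 2 * i + 1 + 2 * l ∈ H := by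
    intro l
    induction l with
    | zero => exact fun _ => hm
    | succ l ih =>
      intro hl
      have hl' := ih (by omega)
      rcases hcover (2 * i + 1 + 2 * l + 3) (by omega) (by omega) with h | h | h
      · have := hadd _ h _ (hevens (l + 2) (by omega) (by omega))
        rw [show 2 * i + 1 + 2 * l + 3 + (f - 2 * (l + 2)) = F by omega] at this
        exact absurd this hF
      · exact h
      · have h' := hadd _ h _ hl'
        refine absurd ?_ (hcons _ h' (by omega))
        rw [show f - (2 * i + 1 + 2 * l + 3) + (2 * i + 1 + 2 * l) + 1 = f - 2 * 1 by omega]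
        exact hevens 1 le_rfl (by omega)
  have h3m := hadd _ (hadd _ hm _ hm) _ hm
  have h3m' := hadd _ (hrow 1 (by omega)) _ (hrow (i - 1) (by omega))
  refine hcons _ h3m' (by omega) ?_
  rwa [show 2 * i + 1 + 2 * 1 + (2 * i + 1 + 2 * (i - 1)) + 1 =
    2 * i + 1 + (2 * i + 1) + (2 * i + 1) by omega]

/-- A semigroup containing `3`, with Frobenius number `F ≡ 1 (mod 3)` and without consecutive
elements below `F`, is Arf. -/
lemma isArf_of_three_mem (H : Set ℕ) (F : ℕ) (h0 : 0 ∈ H)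
    (hadd : ∀ a ∈ H, ∀ b ∈ H, a + b ∈ H) (hF : F ∉ H) (hgt : ∀ x, F < x → x ∈ H)
    (hcons : ∀ x ∈ H, x < F → x + 1 ∉ H) (h3 : 3 ∈ H) (hF3 : F % 3 = 1) : IsArf H := by
  have hmul : ∀ k, 3 * k ∈ H := by
    intro k
    induction k with
    | zero => simpa using h0
    | succ k ih => exact hadd _ ih _ h3
  have hdvd : ∀ x ∈ H, x < F → x % 3 = 0 := by
    intro x hx hxF
    by_contra h
    rcases (show x % 3 = 1 ∨ x % 3 = 2 by omega) with h | h
    · have := hadd _ hx _ (hmul ((F - x) / 3))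
      rw [show x + 3 * ((F - x) / 3) = F by omega] at this
      exact hF this
    · have := hmul ((x + 1) / 3)
      rw [show 3 * ((x + 1) / 3) = x + 1 by omega] at this
      exact hcons x hx hxF this
  intro a ha b hb c hc hcb hba
  rcases lt_trichotomy a F with h | h | h
  · have h1 := hdvd a ha h
    have h2 := hdvd b hb (by omega)
    have h4 := hdvd c hc (by omega)
    have := hmul ((a + b - c) / 3)
    rwa [show 3 * ((a + b - c) / 3) = a + b - c by omega] at this
  · exact absurd (h ▸ ha) hF
  · exact hgt _ (by omega)

open Finset in
/-- The number of indices in `[1, g - 1]` at which the leap equals `c`, counted from `0`. -/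
lemma ncard_leap_eq (H : Set ℕ) (g c : ℕ) :
    {i : ℕ | 1 ≤ i ∧ i ≤ g - 1 ∧ gap H (i + 1) - gap H i = c}.ncard =
      #{k ∈ range (g - 1) | gap H (k + 2) - gap H (k + 1) = c} := by
  rw [← Set.ncard_coe_finset, ← Set.ncard_image_of_injective
    (({k ∈ range (g - 1) | gap H (k + 2) - gap H (k + 1) = c} : Finset ℕ) : Set ℕ)
    (add_left_injective 1)]
  congr 1
  ext i
  simp only [Set.mem_ofPred_eq, coe_filter, mem_range, Set.mem_image]
  constructor
  · rintro ⟨h1, h2, h3⟩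
    obtain ⟨k, rfl⟩ := Nat.exists_eq_add_of_le' h1
    exact ⟨k, ⟨by omega, h3⟩, rfl⟩
  · rintro ⟨k, ⟨h1, h2⟩, rfl⟩
    exact ⟨by omega, by omega, h2⟩

/-- **Corollary.** If `H` is a limit sparse numerical semigroup with even Frobenius
number `ℓ_g = 2g - 2r`, then `H` is an Arf semigroup. -/
theorem limit_sparse_even_isArf (H : Set ℕ) (g r : ℕ) (hg : 1 < g)
    (hH : IsNumericalSemigroupOfGenus H g) (hs : IsSparse H g)
    (hlim : numSingle H g = numDouble H g)
    (hF : gap H g = 2 * g - 2 * r) :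
    IsArf H := by
  classical
  obtain ⟨h0, hadd, hfin, hncard⟩ := hH
  have hfin' : (Set.ofPred fun n => n ∉ H).Finite := hfin
  have hcardg : hfin'.toFinset.card = g := by
    rw [← Set.ncard_eq_toFinset_card _ hfin']
    exact hncard
  have hlt : ∀ k l, k < l → l < g → gap H (k + 1) < gap H (l + 1) := fun k l hkl hl =>
    Nat.nth_lt_nth_of_lt_card hfin' hkl (hcardg.symm ▸ hl)
  have hmem : ∀ k < g, gap H (k + 1) ∉ H := fun k hk =>
    Nat.nth_mem_of_lt_card (p := fun n => n ∉ H) hfin' (hcardg.symm ▸ hk)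
  have hsurj : ∀ x ∉ H, ∃ k < g, gap H (k + 1) = x := by
    intro x hx
    obtain ⟨k, hk, hkx⟩ := Nat.exists_lt_card_finite_nth_eq (p := fun n => n ∉ H) hfin' hx
    exact ⟨k, hcardg ▸ hk, hkx⟩
  have h1H : 1 ∉ H := by
    intro h1
    have hall : ∀ n, n ∈ H := by
      intro n
      induction n with
      | zero => exact h0
      | succ n ih => exact hadd _ ih _ h1
    exact hmem 0 (by omega) (hall _)
  have hgap1 : gap H 1 = 1 := by
    obtain ⟨k, hk, hk1⟩ := hsurj 1 h1H
    rcases Nat.eq_zero_or_pos k with rfl | hk0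
    · exact hk1
    · have h2 := hlt 0 k hk0 hk
      have h3 : gap H (0 + 1) = 0 := by omega
      exact absurd (h3.symm ▸ h0 : gap H (0 + 1) ∈ H) (hmem 0 (by omega))
  obtain ⟨t, rfl⟩ : ∃ t, g = t + 1 := ⟨g - 1, by omega⟩
  set F := gap H (t + 1) with hFdef
  have hF' : F ∉ H := hmem t (by omega)
  have hgt : ∀ x, F < x → x ∈ H := by
    intro x hx
    by_contra h
    obtain ⟨k, hk, rfl⟩ := hsurj x h
    rcases Nat.eq_or_lt_of_le (Nat.lt_succ_iff.1 hk) with rfl | hk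
    · omega
    · have := hlt k t hk (by omega)
      omega
  have hcons : ∀ x ∈ H, x < F → x + 1 ∉ H := by
    intro x hx hxF hx1
    have hx0 : x ≠ 0 := by
      rintro rfl
      exact h1H (by simpa using hx1)
    have hex : ∃ k, x < gap H (k + 1) := ⟨t, hxF⟩
    have hk := Nat.find_spec hex
    have hkt : Nat.find hex ≤ t := Nat.find_min' hex hxF
    obtain ⟨k, hkk⟩ : ∃ k, Nat.find hex = k + 1 := by
      refine Nat.exists_eq_succ_of_ne_zero fun h => ?_
      rw [h, zero_add, hgap1] at hk
      omega
    have hk' : gap H (k + 1) ≤ x := not_lt.1 (Nat.find_min hex (show k < Nat.find hex by omega))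
    rw [hkk] at hk hkt
    have h1 : gap H (k + 1) ≠ x := fun h => hmem k (by omega) (h ▸ hx)
    have h2 : gap H (k + 1 + 1) ≠ x + 1 := fun h => hmem (k + 1) (by omega) (h ▸ hx1)
    have := hs (k + 1) (by omega) (by omega)
    omega
  have hleap : ∀ k < t, gap H (k + 2) - gap H (k + 1) = 1 ∨
      gap H (k + 2) - gap H (k + 1) = 2 := by
    intro k hk
    have h1 := hlt k (k + 1) (by omega) (by omega)
    have h2 := hs (k + 1) (by omega) (by omega)
    rw [show k + 1 + 1 = k + 2 by omega] at h1 h2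
    omega
  have hcount : ∀ s ≤ t,
      ((Finset.range s).filter fun k => gap H (k + 2) - gap H (k + 1) = 1).card +
        ((Finset.range s).filter fun k => gap H (k + 2) - gap H (k + 1) = 2).card = s ∧
      ((Finset.range s).filter fun k => gap H (k + 2) - gap H (k + 1) = 1).card +
        2 * ((Finset.range s).filter fun k => gap H (k + 2) - gap H (k + 1) = 2).card + 1 =
        gap H (s + 1) := by
    intro s
    induction s with
    | zero => simp [hgap1]
    | succ s ih =>
      intro hst
      obtain ⟨ih1, ih2⟩ := ih (by omega)
      have h1 := hlt s (s + 1) (by omega) (by omega)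
      rw [show s + 1 + 1 = s + 2 by omega] at h1 ⊢
      rw [Finset.range_add_one, Finset.filter_insert, Finset.filter_insert]
      rcases hleap s (by omega) with h | h
      · rw [if_pos h, if_neg (by omega), Finset.card_insert_of_notMem (by simp)]
        omega
      · rw [if_neg (by omega), if_pos h, Finset.card_insert_of_notMem (by simp)]
        omega
  obtain ⟨hc1, hc2⟩ := hcount t le_rfl
  rw [numSingle, numDouble, ncard_leap_eq, ncard_leap_eq, Nat.add_sub_cancel] at hlim
  have hgaps : ((Finset.Icc 1 F).filter fun n => n ∉ H).card = t + 1 := by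
    rw [← hcardg]
    congr 1
    ext x
    simp only [Finset.mem_filter, Finset.mem_Icc, Set.Finite.mem_toFinset, Set.mem_ofPred_eq]
    refine ⟨fun h => h.2, fun h => ⟨⟨?_, ?_⟩, h⟩⟩
    · exact Nat.one_le_iff_ne_zero.2 fun hx => h (hx ▸ h0)
    · exact not_lt.1 fun hx => h (hgt x hx)
  have hsum := Finset.card_filter_add_card_filter_not (s := Finset.Icc 1 F) (fun n => n ∈ H)
  rw [hgaps, Nat.card_Icc] at hsum
  have h3 := three_mem_of_card H F h0 hadd hF' ⟨t + 1 - r, by omega⟩ hcons (by omega)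
  exact isArf_of_three_mem H F h0 hadd hF' hgt hcons h3 (by omega)
end
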